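/- arXiv:2410.11728 — 5 statements merged into one kernel-verified Lean document; each statement's English description precedes it below -/
import Mathlib

section
/- Let 𝒞 and ℰ be categories with subobject classifiers, ℰ finitely complete, and F : 𝒞 ⥤ ℰ preserving finite limits. Then the Artin gluing category Gl(F) has a subobject classifier: it is the object of Gl(F) given by (π₂ ∘ i : Ω_{Gl(F)} ⟶ F Ω_𝒞), with truth map the morphism of Gl(F) from (1 ≅ F 1_𝒞) given by the pair (true_{Gl(F)}, true_𝒞), where true_{Gl(F)} : 1 ⟶ Ω_{Gl(F)} is the unique map with i ∘ true_{Gl(F)} = (true_ℰ, F(true_𝒞) ∘ (1 ≅ F 1_𝒞)). Every monomorphism (g : b ⟶ a, k : y ⟶ x) : β → α of Gl(F) is classified by a unique morphism to this object, whose ℰ-component is induced by (χ_g, F(χ_k) ∘ α) and whose 𝒞-component is χ_k. -/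
open CategoryTheory Limits

universe v u v' u'

open CategoryTheory Limits

/-- `t : T ⟶ Ω`, with `T` a terminal object, is a subobject classifier: it is a monomorphism
and every monomorphism `m : U ⟶ X` arises as the pullback of `t` along a unique classifying
map `χ : X ⟶ Ω`. -/
structure IsSubobjectClassifier {C : Type u} [Category.{v} C] {T Ω : C}
    (hT : IsTerminal T) (t : T ⟶ Ω) : Prop where
  mono : Mono t
  classifies : ∀ {U X : C} (m : U ⟶ X), Mono m →
    ∃! χ : X ⟶ Ω, IsPullback (hT.from U) m t χ

variable {C : Type u} [Category.{v} C] {E : Type u'} [Category.{v'} E]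

/-- An object of the Artin gluing category `Gl(F) = Comma (𝟭 E) F` of `F : C ⥤ E`. -/
def glObj (F : C ⥤ E) {e : E} {c : C} (h : e ⟶ F.obj c) : Comma (𝟭 E) F :=
  { left := e, right := c, hom := h }

/-- A morphism of the Artin gluing category from its components. -/
def glHom (F : C ⥤ E) (X Y : Comma (𝟭 E) F)
    (l : X.left ⟶ Y.left) (r : X.right ⟶ Y.right)
    (w : l ≫ Y.hom = X.hom ≫ F.map r) : X ⟶ Y :=
  { left := l, right := r, w := by simpa using w }

theorem gl_isPullback_of_lift {D : Type*} [Category D] {T Ω U X : D} (hT : IsTerminal T)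
    (t : T ⟶ Ω) (m : U ⟶ X) [Mono m] (χ : X ⟶ Ω) (f : U ⟶ T) (w : f ≫ t = m ≫ χ)
    (h : ∀ {Z : D} (p : Z ⟶ X), p ≫ χ = hT.from Z ≫ t → ∃ l : Z ⟶ U, l ≫ m = p) :
    IsPullback f m t χ := by
  refine ⟨⟨w⟩, ⟨PullbackCone.IsLimit.mk w
    (fun s => (h s.snd (by rw [← s.condition, hT.hom_ext s.fst (hT.from _)])).choose)
    (fun s => hT.hom_ext _ _)
    (fun s => (h s.snd (by rw [← s.condition, hT.hom_ext s.fst (hT.from _)])).choose_spec)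
    ?_⟩⟩
  intro s l _ h2
  rw [← cancel_mono m, h2]
  exact (h s.snd (by rw [← s.condition, hT.hom_ext s.fst (hT.from _)])).choose_spec.symm

theorem gl_w {F : C ⥤ E} {β α : Comma (𝟭 E) F} (m : β ⟶ α) :
    m.left ≫ α.hom = β.hom ≫ F.map m.right := m.w

theorem gl_mono_right [HasFiniteLimits E] {F : C ⥤ E} {β α : Comma (𝟭 E) F} (m : β ⟶ α)
    [Mono m] : Mono m.right := by
  constructor
  intro z p q hpq
  let k1 : pullback m.left m.left ⟶ F.obj β.right := pullback.fst m.left m.left ≫ β.hom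
  let k2 : pullback m.left m.left ⟶ F.obj β.right := pullback.snd m.left m.left ≫ β.hom
  let a := prod.lift k1 k2
  let b := prod.lift (F.map p) (F.map q)
  have hc : pullback.fst a b ≫ a = pullback.snd a b ≫ b := pullback.condition
  have h1 := congrArg (· ≫ prod.fst) hc
  have h2 := congrArg (· ≫ prod.snd) hc
  simp only [a, b, Category.assoc, prod.lift_fst, prod.lift_snd] at h1 h2
  let Z := glObj F (pullback.snd a b)
  let P : Z ⟶ β := glHom F Z β (pullback.fst a b ≫ pullback.fst m.left m.left) p
    (by simpa [Z, glObj, k1] using h1)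
  let Q : Z ⟶ β := glHom F Z β (pullback.fst a b ≫ pullback.snd m.left m.left) q
    (by simpa [Z, glObj, k2] using h2)
  have : P = Q := by
    rw [← cancel_mono m]
    ext
    · show (pullback.fst a b ≫ pullback.fst m.left m.left) ≫ m.left =
        (pullback.fst a b ≫ pullback.snd m.left m.left) ≫ m.left
      rw [Category.assoc, pullback.condition, Category.assoc]
    · exact hpq
  exact congrArg CommaMorphism.right this

theorem gl_mono_left [HasFiniteLimits E] {F : C ⥤ E} [PreservesFiniteLimits F]
    {β α : Comma (𝟭 E) F} (m : β ⟶ α) [Mono m] : Mono m.left := by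
  have := gl_mono_right m
  constructor
  intro e s s' h
  have hh : s ≫ β.hom = s' ≫ β.hom := by
    rw [← cancel_mono (F.map m.right)]
    have := congrArg (· ≫ α.hom) h
    simp only [Category.assoc] at this
    erw [gl_w m] at this
    rw [Category.assoc, Category.assoc]
    exact this
  let Z : Comma (𝟭 E) F := glObj F (e := e) (c := β.right) (s ≫ β.hom)
  let P : Z ⟶ β := glHom F Z β s (𝟙 _) (by simp [Z, glObj])
  let Q : Z ⟶ β := glHom F Z β s' (𝟙 _) (by simpa [Z, glObj] using hh.symm)
  have : P = Q := by
    rw [← cancel_mono m]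
    ext
    · exact h
    · rfl
  exact congrArg CommaMorphism.left this

/-- A commutative square over a map out of a terminal object is a pullback in the glued
category if both components are. -/
theorem gl_isPullback_of_components {F : C ⥤ E}
    [PreservesFiniteLimits F] {T Ω β α : Comma (𝟭 E) F} (hT : IsTerminal T)
    (t : T ⟶ Ω) (m : β ⟶ α) [Mono m] (hmr : Mono m.right) (χ : α ⟶ Ω) (f : β ⟶ T)
    (hl : IsPullback f.left m.left t.left χ.left)
    (hr : IsPullback f.right m.right t.right χ.right) : IsPullback f m t χ := by
  apply gl_isPullback_of_lift hT
  · ext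
    · exact hl.w
    · exact hr.w
  intro Z p hp
  have hpl := congrArg CommaMorphism.left hp
  have hpr := congrArg CommaMorphism.right hp
  refine ⟨glHom F Z β (hl.lift (hT.from Z).left p.left hpl.symm)
    (hr.lift (hT.from Z).right p.right hpr.symm) ?_, ?_⟩
  · rw [← cancel_mono (F.map m.right), Category.assoc, Category.assoc, ← F.map_comp,
      hr.lift_snd, ← gl_w p]
    erw [← gl_w m]
    rw [← Category.assoc, hl.lift_snd]
  · ext
    · exact hl.lift_snd _ _ _
    · exact hr.lift_snd _ _ _

theorem gl_isPullback_right [HasFiniteLimits E] {F : C ⥤ E}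
    {T Ω β α : Comma (𝟭 E) F} (hTl : IsTerminal T.left) (hTr : IsTerminal T.right)
    (hFT : IsTerminal (F.obj T.right))
    (t : T ⟶ Ω) (m : β ⟶ α) [Mono m] (χ : α ⟶ Ω) (f : β ⟶ T)
    (h : IsPullback f m t χ) : IsPullback f.right m.right t.right χ.right := by
  have := gl_mono_right m
  apply gl_isPullback_of_lift hTr
  · exact congrArg CommaMorphism.right h.w
  intro z p hp
  let x : α.left ⟶ F.obj α.right := α.hom
  let a := prod.lift x χ.left
  let b := prod.lift (F.map p) (hTl.from (F.obj z) ≫ t.left)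
  have hc : pullback.fst a b ≫ a = pullback.snd a b ≫ b := pullback.condition
  have h1 := congrArg (· ≫ prod.fst) hc
  have h2 := congrArg (· ≫ prod.snd) hc
  simp only [a, b, Category.assoc, prod.lift_fst, prod.lift_snd] at h1 h2
  let Z := glObj F (pullback.snd a b)
  let P : Z ⟶ α := glHom F Z α (pullback.fst a b) p h1
  let Q : Z ⟶ T := glHom F Z T (pullback.snd a b ≫ hTl.from _) (hTr.from z) (hFT.hom_ext _ _)
  have hPQ : Q ≫ t = P ≫ χ := by
    ext
    · refine Eq.trans ?_ h2.symm
      exact Category.assoc _ _ _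
    · exact hp.symm
  exact ⟨(h.lift Q P hPQ).right, congrArg CommaMorphism.right (h.lift_snd Q P hPQ)⟩

theorem gl_isPullback_left [HasFiniteLimits E] {F : C ⥤ E} [PreservesFiniteLimits F]
    {T Ω β α : Comma (𝟭 E) F} (hTl : IsTerminal T.left) (hTr : IsTerminal T.right)
    (hFT : IsTerminal (F.obj T.right))
    (t : T ⟶ Ω) (m : β ⟶ α) [Mono m] (χ : α ⟶ Ω) (f : β ⟶ T)
    (h : IsPullback f m t χ) : IsPullback f.left m.left t.left χ.left := by
  have := gl_mono_left m
  have hr := (gl_isPullback_right hTl hTr hFT t m χ f h).map F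
  apply gl_isPullback_of_lift hTl
  · exact congrArg CommaMorphism.left h.w
  intro e s hs
  have hw : (hTl.from e ≫ T.hom) ≫ F.map t.right = (s ≫ α.hom) ≫ F.map χ.right := by
    have h1 := congrArg (· ≫ Ω.hom) hs
    simp only [Category.assoc] at h1
    erw [gl_w χ, gl_w t] at h1
    rw [Category.assoc, Category.assoc]
    exact h1.symm
  let r : e ⟶ F.obj β.right := hr.lift _ _ hw
  have hrr : r ≫ F.map m.right = s ≫ α.hom := hr.lift_snd _ _ hw
  let Z := glObj F r
  let P : Z ⟶ α := glHom F Z α s m.right hrr.symm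
  let Q : Z ⟶ T := glHom F Z T (hTl.from _) (hTr.from _) (hFT.hom_ext _ _)
  have hPQ : Q ≫ t = P ≫ χ := by
    ext
    · exact hs.symm
    · have := congrArg CommaMorphism.right h.w
      refine Eq.trans ?_ this
      show hTr.from β.right ≫ t.right = f.right ≫ t.right
      rw [hTr.hom_ext f.right (hTr.from _)]
  exact ⟨(h.lift Q P hPQ).left, congrArg CommaMorphism.left (h.lift_snd Q P hPQ)⟩

/-- Let `C` and `E` be categories with subobject classifiers `(Ω_C, t_C)` and
`(Ω_E, t_E)`, `E` finitely complete, `F : C ⥤ E` preserving finite limits.  Let `χF` classify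
`F.map t_C`, let `andMap` classify `(t_E, t_E)`, let `i : Ω_Gl ⟶ Ω_E ⨯ F.obj Ω_C` be the
equalizer of `π₁` and `∧ ∘ (𝟙 × χF)`, and let `t_Gl` be the unique map with
`t_Gl ≫ i = (t_E, F.map t_C ∘ (1 ≅ F 1))`.  Then the object `(π₂ ∘ i : Ω_Gl ⟶ F.obj Ω_C)` of
`Gl(F)`, with truth map `(t_Gl, t_C)` out of the terminal object `(1 ≅ F 1)`, is a subobject
classifier of `Gl(F)`; and every monomorphism `m : β ⟶ α` of `Gl(F)` is classified by a
unique morphism whose `E`-component is induced by `(χ_g, F.map χ_k ∘ α.hom)` and whose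
`C`-component is `χ_k`. -/
theorem stmt3
    [HasFiniteLimits E] [HasTerminal C]
    (F : C ⥤ E) [PreservesFiniteLimits F]
    (ΩE : E) (tE : ⊤_ E ⟶ ΩE)
    (hE : IsSubobjectClassifier terminalIsTerminal tE)
    (ΩC : C) (tC : ⊤_ C ⟶ ΩC)
    (hC : IsSubobjectClassifier terminalIsTerminal tC)
    (χF : F.obj ΩC ⟶ ΩE)
    (hχF : IsPullback (terminal.from (F.obj (⊤_ C))) (F.map tC) tE χF)
    (andMap : ΩE ⨯ ΩE ⟶ ΩE)
    (hand : IsPullback (terminal.from (⊤_ E)) (prod.lift tE tE) tE andMap)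
    (ΩGl : E) (i : ΩGl ⟶ ΩE ⨯ F.obj ΩC)
    (wi : i ≫ prod.fst = i ≫ (prod.map (𝟙 ΩE) χF ≫ andMap))
    (hi : IsLimit (Fork.ofι i wi))
    (tGl : ⊤_ E ⟶ ΩGl)
    (htGl : tGl ≫ i = prod.lift tE ((PreservesTerminal.iso F).inv ≫ F.map tC))
    (hTGl : IsTerminal (glObj F (PreservesTerminal.iso F).inv)) :
    IsSubobjectClassifier hTGl
      (glHom F (glObj F (PreservesTerminal.iso F).inv) (glObj F (i ≫ prod.snd)) tGl tC
        (by show tGl ≫ i ≫ prod.snd = (PreservesTerminal.iso F).inv ≫ F.map tC; rw [← Category.assoc, htGl, prod.lift_snd])) ∧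
    (∀ {β α : Comma (𝟭 E) F} (m : β ⟶ α), Mono m →
      ∀ (χg : α.left ⟶ ΩE), IsPullback (terminal.from β.left) m.left tE χg →
      ∀ (χk : α.right ⟶ ΩC), IsPullback (terminal.from β.right) m.right tC χk →
      ∀ (χ : α ⟶ glObj F (i ≫ prod.snd)),
        IsPullback (hTGl.from β) m
          (glHom F (glObj F (PreservesTerminal.iso F).inv) (glObj F (i ≫ prod.snd)) tGl tC
            (by show tGl ≫ i ≫ prod.snd = (PreservesTerminal.iso F).inv ≫ F.map tC; rw [← Category.assoc, htGl, prod.lift_snd])) χ →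
        (χ.right = χk ∧ χ.left ≫ i = prod.lift χg (α.hom ≫ F.map χk))) := by
  have hFT : IsTerminal (F.obj (⊤_ C)) := IsTerminal.isTerminalObj F _ terminalIsTerminal
  have i_mono : Mono i := mono_of_isLimit_fork hi
  have htG1 : tGl ≫ i ≫ prod.fst = tE := by rw [← Category.assoc, htGl, prod.lift_fst]
  -- points of `andMap`
  have hand' : ∀ {e : E} (u v : e ⟶ ΩE), prod.lift u v ≫ andMap = terminal.from e ≫ tE →
      u = terminal.from e ≫ tE ∧ v = terminal.from e ≫ tE := by
    intro e u v h
    have h2 := hand.lift_snd (terminal.from e) (prod.lift u v) h.symm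
    have h3 := congrArg (· ≫ prod.fst) h2
    have h4 := congrArg (· ≫ prod.snd) h2
    simp only [Category.assoc, prod.lift_fst, prod.lift_snd] at h3 h4
    constructor
    · rw [← h3]; congr 1; exact terminalIsTerminal.hom_ext _ _
    · rw [← h4]; congr 1; exact terminalIsTerminal.hom_ext _ _
  have handT : ∀ {e : E}, prod.lift (terminal.from e ≫ tE) (terminal.from e ≫ tE) ≫ andMap
      = terminal.from e ≫ tE := by
    intro e
    rw [← prod.comp_lift, Category.assoc, ← hand.w, ← Category.assoc]
    congr 1
    exact terminalIsTerminal.hom_ext _ _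
  -- `tGl` is the pullback of `tE` along the first projection
  have hpt : IsPullback (𝟙 (⊤_ E)) tGl tE (i ≫ prod.fst) := by
    have : Mono tGl := terminalIsTerminal.mono_from _
    apply gl_isPullback_of_lift terminalIsTerminal
    · rw [htG1, Category.id_comp]
    intro e u hu
    refine ⟨terminal.from e, ?_⟩
    have hu' : u ≫ i ≫ prod.fst = terminal.from e ≫ tE := hu
    have h1 : prod.lift (u ≫ i ≫ prod.fst) (u ≫ i ≫ prod.snd ≫ χF) ≫ andMap
        = terminal.from e ≫ tE := by
      have h0 : prod.lift (u ≫ i ≫ prod.fst) (u ≫ i ≫ prod.snd ≫ χF)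
          = u ≫ i ≫ prod.map (𝟙 ΩE) χF := by
        apply Limits.prod.hom_ext
        · rw [prod.lift_fst]; simp
        · rw [prod.lift_snd]; simp
      rw [h0, ← hu', wi]
      simp only [Category.assoc]
    have h2 := (hand' _ _ h1).2
    have h3 : terminal.from e ≫ tE = (u ≫ i ≫ prod.snd) ≫ χF := by
      rw [← h2]; simp only [Category.assoc]
    have h4 := hχF.lift_snd _ _ h3
    rw [← cancel_mono i, Category.assoc, htGl]
    apply Limits.prod.hom_ext
    · rw [Category.assoc, prod.lift_fst, Category.assoc, hu']
    · rw [Category.assoc, prod.lift_snd, Category.assoc, ← h4, ← Category.assoc]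
      congr 1
      exact hFT.hom_ext _ _
  have part2 : (∀ {β α : Comma (𝟭 E) F} (m : β ⟶ α), Mono m →
      ∀ (χg : α.left ⟶ ΩE), IsPullback (terminal.from β.left) m.left tE χg →
      ∀ (χk : α.right ⟶ ΩC), IsPullback (terminal.from β.right) m.right tC χk →
      ∀ (χ : α ⟶ glObj F (i ≫ prod.snd)),
        IsPullback (hTGl.from β) m
          (glHom F (glObj F (PreservesTerminal.iso F).inv) (glObj F (i ≫ prod.snd)) tGl tC
            (by show tGl ≫ i ≫ prod.snd = (PreservesTerminal.iso F).inv ≫ F.map tC; rw [← Category.assoc, htGl, prod.lift_snd])) χ →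
        (χ.right = χk ∧ χ.left ≫ i = prod.lift χg (α.hom ≫ F.map χk))) := by
    intro β α m hm χg hg χk hk χ hχ
    have hml := gl_mono_left m
    have hmr := gl_mono_right m
    have hr := gl_isPullback_right (T := glObj F (PreservesTerminal.iso F).inv)
      terminalIsTerminal terminalIsTerminal hFT _ m χ _ hχ
    have hl := gl_isPullback_left (T := glObj F (PreservesTerminal.iso F).inv)
      terminalIsTerminal terminalIsTerminal hFT _ m χ _ hχ
    have er : χ.right = χk := by
      refine (hC.classifies m.right hmr).unique ?_ hk
      have e0 : (hTGl.from β).right = terminalIsTerminal.from β.right :=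
        terminalIsTerminal.hom_ext _ _
      rw [← e0]
      exact hr
    refine ⟨er, ?_⟩
    have el : χ.left ≫ i ≫ prod.fst = χg := by
      refine (hE.classifies m.left hml).unique ?_ hg
      have hl' : IsPullback (hTGl.from β).left m.left tGl χ.left := hl
      have hp := hl'.flip.paste_vert hpt.flip
      have e0 : (hTGl.from β).left ≫ 𝟙 (⊤_ E) = terminalIsTerminal.from β.left :=
        terminalIsTerminal.hom_ext _ _
      rw [← e0]
      exact hp.flip
    apply Limits.prod.hom_ext
    · rw [prod.lift_fst]; exact (Category.assoc _ _ _).trans el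
    · rw [prod.lift_snd, ← er]
      exact (Category.assoc _ _ _).trans (gl_w χ)
  refine ⟨⟨hTGl.mono_from _, ?_⟩, part2⟩
  intro β α m hm
  have hml := gl_mono_left m
  have hmr := gl_mono_right m
  obtain ⟨χg, hg, -⟩ := hE.classifies m.left hml
  obtain ⟨χk, hk, -⟩ := hC.classifies m.right hmr
  let c : α.left ⟶ F.obj ΩC := α.hom ≫ F.map χk
  have hgw : m.left ≫ χg = terminal.from _ ≫ tE := hg.w.symm
  have hcw : m.left ≫ c ≫ χF = terminal.from _ ≫ tE := by
    have h1 : m.left ≫ c = β.hom ≫ F.map (terminal.from _) ≫ F.map tC := by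
      show m.left ≫ α.hom ≫ F.map χk = _
      have := hk.w
      rw [← F.map_comp]
      erw [hk.w]
      rw [F.map_comp, ← Category.assoc, ← Category.assoc]
      congr 1
      exact gl_w m
    rw [← Category.assoc, h1, Category.assoc, Category.assoc, ← hχF.w, ← Category.assoc,
      ← Category.assoc]
    congr 1
    exact terminalIsTerminal.hom_ext _ _
  have heq : χg = prod.lift χg (c ≫ χF) ≫ andMap := by
    refine (hE.classifies m.left hml).unique hg ?_
    apply gl_isPullback_of_lift terminalIsTerminal
    · rw [← Category.assoc, prod.comp_lift, hgw, hcw, handT]; rfl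
    intro e p hp
    rw [← Category.assoc, prod.comp_lift] at hp
    exact ⟨_, hg.lift_snd (terminal.from e) p (hand' _ _ hp).1.symm⟩
  have hfork : prod.lift χg c ≫ prod.fst = prod.lift χg c ≫ (prod.map (𝟙 ΩE) χF ≫ andMap) := by
    rw [prod.lift_fst, ← Category.assoc, prod.lift_map, Category.comp_id]
    exact heq
  obtain ⟨l, hl⟩ : ∃ l : α.left ⟶ ΩGl, l ≫ i = prod.lift χg c :=
    ⟨_, (Fork.IsLimit.lift' hi _ hfork).2⟩
  let χ : α ⟶ glObj F (i ≫ prod.snd) := glHom F α (glObj F (i ≫ prod.snd)) l χk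
    (by show l ≫ i ≫ prod.snd = c
        rw [← Category.assoc, hl, prod.lift_snd])
  refine ⟨χ, ?_, ?_⟩
  · apply gl_isPullback_of_components hTGl _ m hmr
    · have e1 : l ≫ i ≫ prod.fst = χg := by rw [← Category.assoc, hl, prod.lift_fst]
      show IsPullback (hTGl.from β).left m.left tGl l
      apply gl_isPullback_of_lift terminalIsTerminal
      · have h0 : terminal.from β.left ≫ tE = (m.left ≫ l) ≫ i ≫ prod.fst := by
          rw [Category.assoc, e1, hgw]
        rw [← hpt.lift_snd _ _ h0]
        congr 1
        exact terminalIsTerminal.hom_ext _ _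
      intro e p hp
      refine ⟨_, hg.lift_snd (terminal.from e) p ?_⟩
      rw [← e1, ← Category.assoc, hp, Category.assoc, htG1]
      rfl
    · have e0 : (hTGl.from β).right = terminalIsTerminal.from β.right :=
        terminalIsTerminal.hom_ext _ _
      rw [e0]
      exact hk
  · intro χ' hχ'
    obtain ⟨h1, h2⟩ := part2 m hm χg hg χk hk χ' hχ'
    ext
    · refine (cancel_mono i).1 ?_
      exact h2.trans hl.symm
    · exact h1
end

section
/- The morphism (true_ℰ, F(true_𝒞) ∘ (1 ≅ F 1_𝒞)) : 1 ⟶ Ω_ℰ × F Ω_𝒞 equalizes π₁ and ∧ ∘ (id × χ_{F(true)}); hence there is a unique morphism true_{Gl(F)} : 1 ⟶ Ω_{Gl(F)} with i ∘ true_{Gl(F)} = (true_ℰ, F(true_𝒞) ∘ (1 ≅ F 1_𝒞)), and moreover π₂ ∘ i ∘ true_{Gl(F)} = F(true_𝒞) ∘ (1 ≅ F 1_𝒞). -/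
open CategoryTheory Limits

universe v u v' u'

/-- Setting: `C` and `E` have subobject classifiers `(Ω_C, t_C)` and
`(Ω_E, t_E)`, `E` has all finite limits, `F : C ⥤ E` preserves finite limits, `χF` classifies
the monomorphism `F.map t_C`, `andMap` (conjunction) classifies `(t_E, t_E)`, and
`i : Ω_Gl ⟶ Ω_E ⨯ F.obj Ω_C` is the equalizer of `π₁` and `∧ ∘ (𝟙 × χF)`.

The morphism `(t_E, F.map t_C ∘ (1 ≅ F 1))` equalizes `π₁` and `∧ ∘ (𝟙 × χF)`, hence there is
a unique `t_Gl : 1 ⟶ Ω_Gl` with `t_Gl ≫ i = (t_E, F.map t_C ∘ (1 ≅ F 1))`; moreover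
`π₂ ∘ i ∘ t_Gl = F.map t_C ∘ (1 ≅ F 1)`. -/
theorem stmt5 {C : Type u} [Category.{v} C] {E : Type u'} [Category.{v'} E]
    [HasFiniteLimits E] [HasTerminal C]
    (F : C ⥤ E) [PreservesFiniteLimits F]
    (ΩE : E) (tE : ⊤_ E ⟶ ΩE)
    (_hE : IsSubobjectClassifier terminalIsTerminal tE)
    (ΩC : C) (tC : ⊤_ C ⟶ ΩC)
    (_hC : IsSubobjectClassifier terminalIsTerminal tC)
    (χF : F.obj ΩC ⟶ ΩE)
    (_hχF : IsPullback (terminal.from (F.obj (⊤_ C))) (F.map tC) tE χF)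
    (andMap : ΩE ⨯ ΩE ⟶ ΩE)
    (_hand : IsPullback (terminal.from (⊤_ E)) (prod.lift tE tE) tE andMap)
    (ΩGl : E) (i : ΩGl ⟶ ΩE ⨯ F.obj ΩC)
    (wi : i ≫ prod.fst = i ≫ (prod.map (𝟙 ΩE) χF ≫ andMap))
    (_hi : IsLimit (Fork.ofι i wi)) :
    (prod.lift tE ((PreservesTerminal.iso F).inv ≫ F.map tC) ≫ prod.fst =
      prod.lift tE ((PreservesTerminal.iso F).inv ≫ F.map tC) ≫
        (prod.map (𝟙 ΩE) χF ≫ andMap)) ∧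
    (∃! tGl : ⊤_ E ⟶ ΩGl,
      tGl ≫ i = prod.lift tE ((PreservesTerminal.iso F).inv ≫ F.map tC)) ∧
    (∀ tGl : ⊤_ E ⟶ ΩGl,
      tGl ≫ i = prod.lift tE ((PreservesTerminal.iso F).inv ≫ F.map tC) →
      tGl ≫ i ≫ prod.snd = (PreservesTerminal.iso F).inv ≫ F.map tC) := by
  have h1 : ((PreservesTerminal.iso F).inv ≫ F.map tC) ≫ χF = tE := by
    rw [Category.assoc, ← _hχF.w, ← Category.assoc]
    have : (PreservesTerminal.iso F).inv ≫ terminal.from (F.obj (⊤_ C)) = 𝟙 _ :=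
      terminal.hom_ext _ _
    rw [this, Category.id_comp]
  have h2 : prod.lift tE tE ≫ andMap = tE := by
    rw [← _hand.w]
    have : terminal.from (⊤_ E) = 𝟙 _ := terminal.hom_ext _ _
    rw [this, Category.id_comp]
  have key : prod.lift tE ((PreservesTerminal.iso F).inv ≫ F.map tC) ≫ prod.fst =
      prod.lift tE ((PreservesTerminal.iso F).inv ≫ F.map tC) ≫
        (prod.map (𝟙 ΩE) χF ≫ andMap) := by
    rw [prod.lift_fst, ← Category.assoc, prod.lift_map, h1, Category.comp_id, h2]
  refine ⟨key, ?_, ?_⟩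
  · obtain ⟨l, hl⟩ := Fork.IsLimit.lift' _hi _ key
    refine ⟨l, hl, fun y hy => ?_⟩
    exact Fork.IsLimit.hom_ext _hi (hy.trans hl.symm)
  · intro t ht
    rw [← Category.assoc, ht, prod.lift_snd]
end

section
/- The commuting square with top edge the identity of 1, left edge true_{Gl(F)} : 1 ⟶ Ω_{Gl(F)}, bottom edge π₁ ∘ i : Ω_{Gl(F)} ⟶ Ω_ℰ, and right edge true_ℰ : 1 ⟶ Ω_ℰ is a pullback square in ℰ. -/
open CategoryTheory Limits

universe v u v' u'

/-- In the Artin gluing setting (subobject classifiers `(Ω_C, t_C)`,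
`(Ω_E, t_E)`, `E` finitely complete, `F` preserving finite limits, `χF` classifying `F.map t_C`,
`andMap` classifying `(t_E, t_E)`, `i` the equalizer of `π₁` and `∧ ∘ (𝟙 × χF)`, and
`t_Gl : 1 ⟶ Ω_Gl` the unique map with `t_Gl ≫ i = (t_E, F.map t_C ∘ (1 ≅ F 1))`):
the square with top edge `𝟙 1`, left edge `t_Gl`, right edge `t_E`, and bottom edge
`π₁ ∘ i` is a pullback square in `E`. -/
theorem stmt6 {C : Type u} [Category.{v} C] {E : Type u'} [Category.{v'} E]
    [HasFiniteLimits E] [HasTerminal C]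
    (F : C ⥤ E) [PreservesFiniteLimits F]
    (ΩE : E) (tE : ⊤_ E ⟶ ΩE)
    (hE : IsSubobjectClassifier terminalIsTerminal tE)
    (ΩC : C) (tC : ⊤_ C ⟶ ΩC)
    (hC : IsSubobjectClassifier terminalIsTerminal tC)
    (χF : F.obj ΩC ⟶ ΩE)
    (hχF : IsPullback (terminal.from (F.obj (⊤_ C))) (F.map tC) tE χF)
    (andMap : ΩE ⨯ ΩE ⟶ ΩE)
    (hand : IsPullback (terminal.from (⊤_ E)) (prod.lift tE tE) tE andMap)
    (ΩGl : E) (i : ΩGl ⟶ ΩE ⨯ F.obj ΩC)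
    (wi : i ≫ prod.fst = i ≫ (prod.map (𝟙 ΩE) χF ≫ andMap))
    (hi : IsLimit (Fork.ofι i wi))
    (tGl : ⊤_ E ⟶ ΩGl)
    (htGl : tGl ≫ i = prod.lift tE ((PreservesTerminal.iso F).inv ≫ F.map tC)) :
    IsPullback (𝟙 (⊤_ E)) tGl tE (i ≫ prod.fst) := by
  have hfst : tGl ≫ i ≫ prod.fst = tE := by
    rw [← Category.assoc, htGl, prod.lift_fst]
  refine ⟨⟨by rw [hfst, Category.id_comp]⟩, ⟨PullbackCone.IsLimit.mk _ (fun s => s.fst)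
    (fun s => Category.comp_id _) (fun s => ?_) (fun s m hm _ => Subsingleton.elim _ _)⟩⟩
  have hs : s.fst ≫ tE = s.snd ≫ i ≫ prod.fst := s.condition
  have h1 : s.fst ≫ tE = (s.snd ≫ i ≫ prod.map (𝟙 ΩE) χF) ≫ andMap := by
    have := congrArg (fun f => s.snd ≫ f) wi
    simp only [Category.assoc]
    exact hs.trans this
  have h2 := hand.lift_snd _ _ h1
  have h3 : hand.lift _ _ h1 ≫ tE = (s.snd ≫ i ≫ prod.snd) ≫ χF := by
    have := congrArg (fun f => f ≫ prod.snd) h2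
    simpa only [Category.assoc, prod.lift_snd, prod.map_snd] using this
  have h4 := hχF.lift_snd _ _ h3
  have h5 : hχF.lift _ _ h3 = s.fst ≫ (PreservesTerminal.iso F).inv := by
    rw [← cancel_mono (PreservesTerminal.iso F).hom]
    exact Subsingleton.elim _ _
  apply Fork.IsLimit.hom_ext hi
  change (s.fst ≫ tGl) ≫ i = s.snd ≫ i
  rw [Category.assoc, htGl]
  apply Limits.prod.hom_ext
  · simpa only [Category.assoc, prod.lift_fst] using hs
  · rw [h5] at h4
    simpa only [Category.assoc, prod.lift_snd] using h4
end

section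
/- Let (g : b ⟶ a, k : y ⟶ x) be a monomorphism of Gl(F) from β : b ⟶ F y to α : a ⟶ F x (so g and k are monomorphisms), with classifying maps χ_g : a ⟶ Ω_ℰ of g and χ_k : x ⟶ Ω_𝒞 of k. Then the map (χ_g, F(χ_k) ∘ α) : a ⟶ Ω_ℰ × F Ω_𝒞 equalizes π₁ and ∧ ∘ (id × χ_{F(true)}), so it factors uniquely through i as a map χ_β : a ⟶ Ω_{Gl(F)}; moreover π₂ ∘ i ∘ χ_β = F(χ_k) ∘ α and χ_β ∘ g = true_{Gl(F)} ∘ !, where ! : b ⟶ 1 is the terminal map. -/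
open CategoryTheory Limits

universe v u v' u'

/-- In the Artin gluing setting, let `m = (g, k) : β ⟶ α` be a monomorphism
of `Gl(F) = Comma (𝟭 E) F`, with classifying maps `χg` of `g = m.left` and `χk` of
`k = m.right`.  Then `(χg, F.map χk ∘ α.hom)` equalizes `π₁` and `∧ ∘ (𝟙 × χF)`, so it
factors uniquely through the equalizer `i` as `χβ : α.left ⟶ Ω_Gl`; moreover
`π₂ ∘ i ∘ χβ = F.map χk ∘ α.hom` and `χβ ∘ g = t_Gl ∘ !`. -/
theorem stmt7 {C : Type u} [Category.{v} C] {E : Type u'} [Category.{v'} E]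
    [HasFiniteLimits E] [HasTerminal C]
    (F : C ⥤ E) [PreservesFiniteLimits F]
    (ΩE : E) (tE : ⊤_ E ⟶ ΩE)
    (hE : IsSubobjectClassifier terminalIsTerminal tE)
    (ΩC : C) (tC : ⊤_ C ⟶ ΩC)
    (hC : IsSubobjectClassifier terminalIsTerminal tC)
    (χF : F.obj ΩC ⟶ ΩE)
    (hχF : IsPullback (terminal.from (F.obj (⊤_ C))) (F.map tC) tE χF)
    (andMap : ΩE ⨯ ΩE ⟶ ΩE)
    (hand : IsPullback (terminal.from (⊤_ E)) (prod.lift tE tE) tE andMap)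
    (ΩGl : E) (i : ΩGl ⟶ ΩE ⨯ F.obj ΩC)
    (wi : i ≫ prod.fst = i ≫ (prod.map (𝟙 ΩE) χF ≫ andMap))
    (hi : IsLimit (Fork.ofι i wi))
    (tGl : ⊤_ E ⟶ ΩGl)
    (htGl : tGl ≫ i = prod.lift tE ((PreservesTerminal.iso F).inv ≫ F.map tC))
    {β α : Comma (𝟭 E) F} (m : β ⟶ α) (hm : Mono m)
    (χg : α.left ⟶ ΩE)
    (hχg : IsPullback (terminal.from β.left) m.left tE χg)
    (χk : α.right ⟶ ΩC)
    (hχk : IsPullback (terminal.from β.right) m.right tC χk) :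
    (prod.lift χg (α.hom ≫ F.map χk) ≫ prod.fst =
      prod.lift χg (α.hom ≫ F.map χk) ≫ (prod.map (𝟙 ΩE) χF ≫ andMap)) ∧
    (∃! χβ : α.left ⟶ ΩGl, χβ ≫ i = prod.lift χg (α.hom ≫ F.map χk)) ∧
    (∀ χβ : α.left ⟶ ΩGl, χβ ≫ i = prod.lift χg (α.hom ≫ F.map χk) →
      χβ ≫ i ≫ prod.snd = α.hom ≫ F.map χk ∧
      m.left ≫ χβ = terminal.from β.left ≫ tGl) := by
  have hgmono : Mono m.left := by
    haveI := hE.mono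
    constructor
    intro Z f h hfh
    exact hχg.hom_ext (Subsingleton.elim _ _) hfh
  have hFT : IsTerminal (F.obj (⊤_ C)) := terminalIsTerminal.isTerminalObj F _
  have hw : m.left ≫ α.hom = β.hom ≫ F.map m.right := m.w
  have hsnd : m.left ≫ α.hom ≫ F.map χk =
      β.hom ≫ F.map (terminal.from β.right) ≫ F.map tC := by
    rw [← Category.assoc, hw, Category.assoc, ← F.map_comp, ← F.map_comp, hχk.w]
  have hψ : prod.lift χg (α.hom ≫ F.map χk) ≫ (prod.map (𝟙 ΩE) χF ≫ andMap) =
      prod.lift χg ((α.hom ≫ F.map χk) ≫ χF) ≫ andMap := by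
    rw [← Category.assoc, prod.lift_map, Category.comp_id]
  have hpb : IsPullback (terminal.from β.left) m.left tE
      (prod.lift χg ((α.hom ≫ F.map χk) ≫ χF) ≫ andMap) := by
    have hcomm : m.left ≫ prod.lift χg ((α.hom ≫ F.map χk) ≫ χF) =
        terminal.from β.left ≫ prod.lift tE tE := by
      apply Limits.prod.hom_ext
      · simp only [Category.assoc, prod.lift_fst]
        exact hχg.w.symm
      · simp only [Category.assoc, prod.lift_snd]
        have h1 := congrArg (fun z => z ≫ χF) hsnd
        simp only [Category.assoc] at h1
        rw [h1, ← hχF.w]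
        simp only [← Category.assoc]
        congr 1
        exact Subsingleton.elim _ _
    refine ⟨⟨?_⟩, ⟨PullbackCone.IsLimit.mk _
      (fun s => hχg.lift s.fst s.snd ?_) ?_ ?_ ?_⟩⟩
    · rw [← Category.assoc, hcomm, Category.assoc, ← hand.w, ← Category.assoc]
      congr 1
      exact Subsingleton.elim _ _
    · have h := s.condition
      rw [← Category.assoc] at h
      have h2 := hand.lift_snd s.fst _ h
      have h3 := congrArg (fun z => z ≫ prod.fst) h2
      simp only [Category.assoc, prod.lift_fst] at h3
      rw [← h3]
      congr 1
      exact Subsingleton.elim _ _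
    · intro s
      exact Subsingleton.elim _ _
    · intro s
      exact hχg.lift_snd _ _ _
    · intro s l h1 h2
      rw [← cancel_mono m.left, h2]
      exact (hχg.lift_snd _ _ _).symm
  have heq : prod.lift χg (α.hom ≫ F.map χk) ≫ prod.fst =
      prod.lift χg (α.hom ≫ F.map χk) ≫ (prod.map (𝟙 ΩE) χF ≫ andMap) := by
    rw [hψ, prod.lift_fst]
    obtain ⟨χ, _, hu⟩ := hE.classifies m.left hgmono
    exact (hu _ hχg).trans (hu _ hpb).symm
  refine ⟨heq, ?_, ?_⟩
  · obtain ⟨l, hl⟩ := Fork.IsLimit.lift' hi _ heq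
    refine ⟨l, hl, ?_⟩
    intro y hy
    exact Fork.IsLimit.hom_ext hi (hy.trans hl.symm)
  · intro χβ h
    refine ⟨?_, ?_⟩
    · rw [← Category.assoc, h, prod.lift_snd]
    · apply Fork.IsLimit.hom_ext hi
      change (m.left ≫ χβ) ≫ i = (terminal.from β.left ≫ tGl) ≫ i
      rw [Category.assoc, Category.assoc, h, htGl]
      apply Limits.prod.hom_ext
      · simp only [Category.assoc, prod.lift_fst]
        exact hχg.w.symm
      · simp only [Category.assoc, prod.lift_snd]
        rw [hsnd]
        simp only [← Category.assoc]
        congr 1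
        exact hFT.hom_ext _ _
end

section
/- There exist functors X, Y from the poset (ℕ, ≤), regarded as a category, to the category FinSet of finite sets such that the exponential Y^X does not exist in the functor category FinSet^{(ℕ,≤)}; consequently the finitely complete category FinSet^{(ℕ,≤)} is not cartesian closed, even though FinSet itself is cartesian closed. -/
open CategoryTheory Limits

/-- `Z`, equipped with the evaluation map `ev : Z ⨯ X ⟶ Y`, is an exponential `Y^X`:
it represents the functor `Hom(− ⨯ X, Y)`. -/
def IsExponential {C : Type*} [Category C] [HasBinaryProducts C]
    (X Y Z : C) (ev : Z ⨯ X ⟶ Y) : Prop :=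
  ∀ (W : C) (f : W ⨯ X ⟶ Y), ∃! g : W ⟶ Z, prod.map g (𝟙 X) ≫ ev = f

/-- The growing sequence of finite sets `{0, …, n}`. -/
def XX : ℕ ⥤ FintypeCat.{0} where
  obj n := FintypeCat.of (Fin (n + 1))
  map {m n} f := FintypeCat.homMk fun i => ⟨i.1, by have := i.2; have := leOfHom f; omega⟩
  map_id n := by ext i; rfl
  map_comp f g := by ext i; rfl

/-- The constant functor with value `Bool`. -/
def YY : ℕ ⥤ FintypeCat.{0} := (Functor.const ℕ).obj (FintypeCat.of Bool)

/-- The natural transformation that is the indicator of `k`. -/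
def phi (k : ℕ) : XX ⟶ YY where
  app n := FintypeCat.homMk (X := FintypeCat.of (Fin (n + 1))) (Y := FintypeCat.of Bool)
    fun i => decide (i.1 = k)
  naturality m n f := by
    apply FintypeCat.hom_ext
    intro i
    rfl

theorem phi_inj : Function.Injective phi := by
  intro k l h
  have h1 := congrArg (fun t : XX ⟶ YY => t.app k) h
  have h2 : decide (k = k) = decide (k = l) :=
    ConcreteCategory.congr_hom h1 (⟨k, by omega⟩ : Fin (k + 1))
  simpa using h2

/-- The terminal functor. -/
def TT : ℕ ⥤ FintypeCat.{0} := (Functor.const ℕ).obj (FintypeCat.of PUnit)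

/-- The map to the terminal functor. -/
def bang (X : ℕ ⥤ FintypeCat.{0}) : X ⟶ TT where
  app n := FintypeCat.homMk (Y := FintypeCat.of PUnit) fun _ => PUnit.unit
  naturality m n f := by
    apply FintypeCat.hom_ext
    intro i
    rfl

theorem TT_ext {Z : ℕ ⥤ FintypeCat.{0}} (g h : TT ⟶ Z)
    (e : g.app 0 = h.app 0) : g = h := by
  ext1
  funext n
  have hg := g.naturality (homOfLE (Nat.zero_le n))
  have hh := h.naturality (homOfLE (Nat.zero_le n))
  have ht : TT.map (homOfLE (Nat.zero_le n)) = 𝟙 (FintypeCat.of PUnit) := rfl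
  rw [ht] at hg hh
  have hg' : g.app n = g.app 0 ≫ Z.map (homOfLE (Nat.zero_le n)) := hg
  have hh' : h.app n = h.app 0 ≫ Z.map (homOfLE (Nat.zero_le n)) := hh
  rw [hg', hh', e]

theorem no_exp : ¬ ∃ (Z : ℕ ⥤ FintypeCat.{0}) (ev : Z ⨯ XX ⟶ YY), IsExponential XX YY Z ev := by
  rintro ⟨Z, ev, H⟩
  choose g hg _ using fun k => H TT (prod.snd ≫ phi k)
  obtain ⟨k, l, hkl, e⟩ := Finite.exists_ne_map_eq_of_infinite (fun k => (g k).app 0)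
  have e' : g k = g l := TT_ext _ _ e
  have h1 : (prod.snd : TT ⨯ XX ⟶ XX) ≫ phi k = prod.snd ≫ phi l := by
    rw [← hg k, ← hg l, e']
  have h2 := congrArg (fun t => prod.lift (bang XX) (𝟙 XX) ≫ t) h1
  simp only [prod.lift_snd_assoc, Category.id_comp] at h2
  exact hkl (phi_inj h2)

theorem pair_eq {W X : FintypeCat.{0}} (p : (W ⨯ X : FintypeCat.{0})) :
    (prod.lift (FintypeCat.homMk fun _ => (prod.fst : W ⨯ X ⟶ W) p) (𝟙 X) : X ⟶ W ⨯ X)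
      ((prod.snd : W ⨯ X ⟶ X) p) = p := by
  let c : FintypeCat.of PUnit.{1} ⟶ W ⨯ X := FintypeCat.homMk fun _ => p
  have : c ≫ prod.snd ≫
      prod.lift (FintypeCat.homMk fun _ => (prod.fst : W ⨯ X ⟶ W) p) (𝟙 X) = c := by
    apply Limits.prod.hom_ext
    · simp only [Category.assoc, prod.lift_fst]
      rfl
    · simp only [Category.assoc, prod.lift_snd, Category.comp_id]
  exact ConcreteCategory.congr_hom this PUnit.unit

theorem fin_exp (X Y : FintypeCat.{0}) :
    ∃ (Z : FintypeCat.{0}) (ev : Z ⨯ X ⟶ Y), IsExponential X Y Z ev := by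
  let Z : FintypeCat.{0} := FintypeCat.of (X → Y)
  let ev : Z ⨯ X ⟶ Y := FintypeCat.homMk fun p =>
    ((prod.fst : Z ⨯ X ⟶ Z) p : X → Y) ((prod.snd : Z ⨯ X ⟶ X) p)
  have key : ∀ (W : FintypeCat.{0}) (g : W ⟶ Z) (p : (W ⨯ X : FintypeCat.{0})),
      (prod.map g (𝟙 X) ≫ ev) p =
        (g ((prod.fst : W ⨯ X ⟶ W) p) : X → Y) ((prod.snd : W ⨯ X ⟶ X) p) := by
    intro W g p
    have h1 := ConcreteCategory.congr_hom (prod.map_fst g (𝟙 X)) p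
    have h2 := ConcreteCategory.congr_hom (prod.map_snd g (𝟙 X)) p
    exact congr (congrArg (fun t : Z => (t : X → Y)) h1) h2
  refine ⟨Z, ev, fun W f => ⟨FintypeCat.homMk fun w => fun x =>
    f ((prod.lift (FintypeCat.homMk fun _ => w) (𝟙 X) : X ⟶ W ⨯ X) x), ?_, ?_⟩⟩
  · apply FintypeCat.hom_ext
    intro p
    rw [key]
    exact congrArg f (pair_eq p)
  · intro h hh
    apply FintypeCat.hom_ext
    intro w
    funext x
    let q : X ⟶ W ⨯ X := prod.lift (FintypeCat.homMk fun _ => w) (𝟙 X)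
    have h0 := key W h (q x)
    have h1 : (prod.fst : W ⨯ X ⟶ W) (q x) = w :=
      ConcreteCategory.congr_hom (prod.lift_fst (FintypeCat.homMk fun _ => w) (𝟙 X)) x
    have h2 : (prod.snd : W ⨯ X ⟶ X) (q x) = x :=
      ConcreteCategory.congr_hom
        (prod.lift_snd (FintypeCat.homMk fun _ => w : X ⟶ W) (𝟙 X)) x
    rw [hh, h1, h2] at h0
    exact h0.symm

/-- There exist functors `X Y : (ℕ, ≤) ⥤ FinSet` such that the exponential
`Y^X` does not exist in the functor category `FinSet^(ℕ,≤)`; consequently `FinSet^(ℕ,≤)` is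
not cartesian closed, even though `FinSet` itself is cartesian closed.  (Here `FinSet` is
`FintypeCat`, the category of finite types.) -/
theorem stmt19 :
    ∃ X Y : ℕ ⥤ FintypeCat.{0},
      (¬ ∃ (Z : ℕ ⥤ FintypeCat.{0}) (ev : Z ⨯ X ⟶ Y), IsExponential X Y Z ev) ∧
      (¬ ∀ X' Y' : ℕ ⥤ FintypeCat.{0},
        ∃ (Z : ℕ ⥤ FintypeCat.{0}) (ev : Z ⨯ X' ⟶ Y'), IsExponential X' Y' Z ev) ∧
      (∀ X' Y' : FintypeCat.{0},
        ∃ (Z : FintypeCat.{0}) (ev : Z ⨯ X' ⟶ Y'), IsExponential X' Y' Z ev) := by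
  exact ⟨XX, YY, no_exp, fun h => no_exp (h XX YY), fin_exp⟩
end
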